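/- arXiv:2310.07608 — 3 statements merged into one kernel-verified Lean document; each statement's English description precedes it below -/
import Mathlib

section
/- Let n ≥ 1 and let L be a real n×n matrix whose off-diagonal entries are all nonpositive and each of whose row sums is zero (i.e., L·𝟙ₙ = 0, where 𝟙ₙ is the all-ones vector), and let B = diag(b₁,…,bₙ) be a diagonal matrix with nonnegative diagonal entries. Assume L + B is invertible and that the vectors q = (L+B)⁻¹𝟙ₙ and p = (L+B)⁻ᵀ𝟙ₙ have all entries strictly positive. Then the diagonal matrix P = diag(p₁/q₁, …, pₙ/qₙ) is positive definite, and the matrix Q = P(L+B) + (L+B)ᵀP is positive definite. -/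
open Matrix

/-- A quadratic form with nonpositive off-diagonal entries dominates the diagonal form given by its
row and column sums. -/
theorem sum_rowSum_add_colSum_mul_sq_le {ι : Type*} [Fintype ι] (C : Matrix ι ι ℝ)
    (hC : ∀ i j, i ≠ j → C i j ≤ 0) (y : ι → ℝ) :
    ∑ i, (∑ j, C i j + ∑ j, C j i) * y i ^ 2 ≤ 2 * ∑ i, ∑ j, C i j * y i * y j := by
  have hsum : ∑ i, (∑ j, C i j + ∑ j, C j i) * y i ^ 2 =
      ∑ i, ∑ j, C i j * (y i ^ 2 + y j ^ 2) := by
    simp only [add_mul, mul_add, Finset.sum_mul, Finset.sum_add_distrib]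
    congr 1
    exact Finset.sum_comm
  rw [hsum, Finset.mul_sum]
  refine Finset.sum_le_sum fun i _ => ?_
  rw [Finset.mul_sum]
  refine Finset.sum_le_sum fun j _ => ?_
  rcases eq_or_ne i j with rfl | hij
  · exact le_of_eq (by ring)
  · nlinarith [mul_nonneg (neg_nonneg.mpr (hC i j hij)) (sq_nonneg (y i - y j))]

/-- A matrix `A` with nonpositive off-diagonal entries that maps a positive vector `q` to a positive
vector, and whose transpose does the same to `p`, is diagonally stable with weights `pᵢ / qᵢ`. -/
theorem posDef_diagonal_div_mul_add_transpose_mul {ι : Type*} [Fintype ι] [DecidableEq ι]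
    (A : Matrix ι ι ℝ) (hA : ∀ i j, i ≠ j → A i j ≤ 0) {q p : ι → ℝ}
    (hq : ∀ i, 0 < q i) (hp : ∀ i, 0 < p i)
    (hAq : ∀ i, 0 < (A *ᵥ q) i) (hAp : ∀ i, 0 < (Aᵀ *ᵥ p) i) :
    (diagonal (fun i => p i / q i) * A + Aᵀ * diagonal (fun i => p i / q i)).PosDef := by
  refine PosDef.of_dotProduct_mulVec_pos ?_ fun x hx => ?_
  · simp [IsHermitian, conjTranspose_eq_transpose_of_trivial, add_comm]
  have hform : star x ⬝ᵥ ((diagonal (fun i => p i / q i) * A +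
      Aᵀ * diagonal (fun i => p i / q i)) *ᵥ x) =
      2 * ∑ i, ∑ j, p i * A i j * q j * (x i / q i) * (x j / q j) := by
    rw [star_trivial, add_mulVec, dotProduct_add, ← mulVec_mulVec, ← mulVec_mulVec,
      dotProduct_mulVec x Aᵀ, vecMul_transpose]
    simp only [dotProduct, mulVec_diagonal]
    rw [two_mul, ← Finset.sum_add_distrib, ← Finset.sum_add_distrib]
    refine Finset.sum_congr rfl fun i _ => ?_
    have hrow : ∑ j, p i * A i j * q j * (x i / q i) * (x j / q j) =
        p i * (x i / q i) * (A *ᵥ x) i := by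
      rw [mulVec, dotProduct, Finset.mul_sum]
      refine Finset.sum_congr rfl fun j _ => ?_
      field_simp [(hq j).ne']
    rw [hrow]
    ring
  have hbound := sum_rowSum_add_colSum_mul_sq_le (fun i j => p i * A i j * q j)
    (fun i j hij => mul_nonpos_of_nonpos_of_nonneg
      (mul_nonpos_of_nonneg_of_nonpos (hp i).le (hA i j hij)) (hq j).le) (fun i => x i / q i)
  rw [hform]
  refine lt_of_lt_of_le ?_ hbound
  have hcoeff : ∀ i, 0 < ∑ j, p i * A i j * q j + ∑ j, p j * A j i * q i := fun i => by
    have hrow : ∑ j, p i * A i j * q j = p i * (A *ᵥ q) i := by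
      simp [mulVec, dotProduct, Finset.mul_sum, mul_assoc]
    have hcol : ∑ j, p j * A j i * q i = (Aᵀ *ᵥ p) i * q i := by
      simp [mulVec, dotProduct, Finset.mul_sum, mul_comm]
    rw [hrow, hcol]
    exact add_pos (mul_pos (hp i) (hAq i)) (mul_pos (hAp i) (hq i))
  obtain ⟨k, hk⟩ := Function.ne_iff.mp hx
  refine Finset.sum_pos' (fun i _ => mul_nonneg (hcoeff i).le (sq_nonneg _))
    ⟨k, Finset.mem_univ k, mul_pos (hcoeff k) ?_⟩
  exact sq_pos_of_ne_zero (div_ne_zero hk (hq k).ne')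

/-- Construction of Lyapunov matrices for directed leader-follower graphs
(Theorem 1 of the paper, citing Zhang et al.): if `L` has nonpositive
off-diagonal entries and zero row sums, `B` is diagonal with nonnegative
entries, `L + B` is invertible, and `q = (L+B)⁻¹𝟙` and `p = (L+B)⁻ᵀ𝟙` are
entrywise positive, then `P = diag(pᵢ/qᵢ)` and `Q = P(L+B) + (L+B)ᵀP` are
positive definite. -/
theorem stmt0 (n : ℕ) (hn : 1 ≤ n)
    (L : Matrix (Fin n) (Fin n) ℝ)
    (hL_offdiag : ∀ i j, i ≠ j → L i j ≤ 0)
    (hL_rowsum : L *ᵥ (fun _ => (1 : ℝ)) = 0)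
    (b : Fin n → ℝ) (hb : ∀ i, 0 ≤ b i)
    (hinv : IsUnit (L + diagonal b).det)
    (q p : Fin n → ℝ)
    (hq : q = (L + diagonal b)⁻¹ *ᵥ (fun _ => (1 : ℝ)))
    (hp : p = ((L + diagonal b)ᵀ)⁻¹ *ᵥ (fun _ => (1 : ℝ)))
    (hqpos : ∀ i, 0 < q i) (hppos : ∀ i, 0 < p i) :
    (diagonal (fun i => p i / q i)).PosDef ∧
    ((diagonal (fun i => p i / q i)) * (L + diagonal b) +
      (L + diagonal b)ᵀ * (diagonal (fun i => p i / q i))).PosDef := by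
  have hAq : (L + diagonal b) *ᵥ q = fun _ => 1 := by
    rw [hq, mulVec_mulVec, mul_nonsing_inv _ hinv, one_mulVec]
  have hAp : (L + diagonal b)ᵀ *ᵥ p = fun _ => 1 := by
    rw [hp, mulVec_mulVec, mul_nonsing_inv _ (by rwa [det_transpose]), one_mulVec]
  refine ⟨PosDef.diagonal fun i => div_pos (hppos i) (hqpos i),
    posDef_diagonal_div_mul_add_transpose_mul _ (fun i j hij => ?_) hqpos hppos
      (fun i => by rw [hAq]; exact one_pos) (fun i => by rw [hAp]; exact one_pos)⟩
  simpa [diagonal_apply_ne _ hij] using hL_offdiag i j hij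
end

section
/- Let L and B be real n×n matrices with L + B invertible, set q = (L+B)⁻¹𝟙ₙ and p = (L+B)⁻ᵀ𝟙ₙ, and assume every entry qᵢ of q is nonzero. Define P = diag(p₁/q₁, …, pₙ/qₙ) and Q = P(L+B) + (L+B)ᵀP. Then for every index i, the i-th entry of the vector Qq equals pᵢ/qᵢ + 1. In particular, if all entries of p and q are strictly positive, then all entries of Qq are strictly positive. -/
open Matrix

/-- Key identity in the proof of the paper's Theorem 1: with
`q = (L+B)⁻¹𝟙`, `p = (L+B)⁻ᵀ𝟙`, `P = diag(pᵢ/qᵢ)` and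
`Q = P(L+B) + (L+B)ᵀP`, the vector `Qq` has `i`-th entry `pᵢ/qᵢ + 1`;
in particular `Qq` is entrywise positive whenever `p` and `q` are. -/
theorem stmt2 (n : ℕ) (L B : Matrix (Fin n) (Fin n) ℝ)
    (hinv : IsUnit (L + B).det)
    (q p : Fin n → ℝ)
    (hq : q = (L + B)⁻¹ *ᵥ (fun _ => (1 : ℝ)))
    (hp : p = ((L + B)ᵀ)⁻¹ *ᵥ (fun _ => (1 : ℝ)))
    (hq0 : ∀ i, q i ≠ 0) :
    (∀ i, ((diagonal (fun i => p i / q i) * (L + B) +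
        (L + B)ᵀ * diagonal (fun i => p i / q i)) *ᵥ q) i = p i / q i + 1) ∧
    ((∀ i, 0 < p i) → (∀ i, 0 < q i) →
      ∀ i, 0 < ((diagonal (fun i => p i / q i) * (L + B) +
        (L + B)ᵀ * diagonal (fun i => p i / q i)) *ᵥ q) i) := by
  have hMq : (L + B) *ᵥ q = fun _ => (1 : ℝ) := by
    rw [hq, mulVec_mulVec, mul_nonsing_inv _ hinv, one_mulVec]
  have hMp : (L + B)ᵀ *ᵥ p = fun _ => (1 : ℝ) := by
    rw [hp, mulVec_mulVec, mul_nonsing_inv _ (by rwa [det_transpose]), one_mulVec]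
  have hPq : diagonal (fun i => p i / q i) *ᵥ q = p := by
    ext i
    rw [mulVec_diagonal, div_mul_cancel₀ _ (hq0 i)]
  have key : ∀ i, ((diagonal (fun i => p i / q i) * (L + B) +
      (L + B)ᵀ * diagonal (fun i => p i / q i)) *ᵥ q) i = p i / q i + 1 := by
    intro i
    rw [add_mulVec, ← mulVec_mulVec, ← mulVec_mulVec, hMq, hPq, hMp, Pi.add_apply,
      mulVec_diagonal, mul_one]
  refine ⟨key, fun hp0 hq_pos i => ?_⟩
  rw [key i]
  have := div_pos (hp0 i) (hq_pos i)
  linarith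
end

section
/- Let n ≥ 1, let k₁, k₂ > 0 be real constants, let P = diag(p₁,…,pₙ) be a real diagonal positive definite n×n matrix, let M be a real n×n matrix, and define Q = PM + MᵀP. Let x̄ₑ, δ̃ : ℝ → ℝ^{2n} be differentiable functions and let R : ℝ → ℝ^{2n×2n} be a function such that for every t, R(t) is block diagonal with 2×2 diagonal blocks, and suppose for all t: x̄ₑ′(t) = −k₁(M ⊗ I₂)x̄ₑ(t) − k₂R(t)δ̃(t) and δ̃′(t) = k₂R(t)ᵀx̄ₑ(t). Define V(t) = x̄ₑ(t)ᵀ(P⊗I₂)x̄ₑ(t) + δ̃(t)ᵀ(P⊗I₂)δ̃(t). Then V is differentiable and for all t, V′(t) = −k₁·x̄ₑ(t)ᵀ(Q⊗I₂)x̄ₑ(t). -/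
open Matrix Kronecker

theorem Matrix.IsSymm.dotProduct_mulVec_comm {m α : Type*} [Fintype m] [CommSemiring α]
    {A : Matrix m m α} (hA : A.IsSymm) (u v : m → α) : u ⬝ᵥ (A *ᵥ v) = v ⬝ᵥ (A *ᵥ u) := by
  rw [dotProduct_mulVec, ← mulVec_transpose, hA.eq, dotProduct_comm]

theorem HasDerivAt.dotProduct {m : Type*} [Fintype m] {u v : ℝ → m → ℝ} {u' v' : m → ℝ} {t : ℝ}
    (hu : HasDerivAt u u' t) (hv : HasDerivAt v v' t) :
    HasDerivAt (fun s => u s ⬝ᵥ v s) (u' ⬝ᵥ v t + u t ⬝ᵥ v') t := by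
  rw [hasDerivAt_pi] at hu hv
  simp only [_root_.dotProduct, ← Finset.sum_add_distrib]
  exact HasDerivAt.fun_sum fun i _ => (hu i).mul (hv i)

theorem HasDerivAt.matrix_mulVec {l m : Type*} [Fintype l] [Fintype m] (A : Matrix l m ℝ)
    {u : ℝ → m → ℝ} {u' : m → ℝ} {t : ℝ} (hu : HasDerivAt u u' t) :
    HasDerivAt (fun s => A *ᵥ u s) (A *ᵥ u') t :=
  (LinearMap.toContinuousLinearMap A.mulVecLin).hasFDerivAt.comp_hasDerivAt t hu

/-- The derivative of a symmetric quadratic form along a curve. -/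
theorem HasDerivAt.dotProduct_mulVec_self {m : Type*} [Fintype m] {A : Matrix m m ℝ}
    (hA : A.IsSymm) {u : ℝ → m → ℝ} {u' : m → ℝ} {t : ℝ} (hu : HasDerivAt u u' t) :
    HasDerivAt (fun s => u s ⬝ᵥ (A *ᵥ u s)) (2 * (u t ⬝ᵥ (A *ᵥ u'))) t := by
  have h := hu.dotProduct (hu.matrix_mulVec A)
  rwa [hA.dotProduct_mulVec_comm u', ← two_mul] at h

/-- `diagonal p ⊗ₖ 1` commutes with every block diagonal matrix. -/
theorem Matrix.commute_diagonal_kronecker_one {m l α : Type*} [Fintype m] [Fintype l]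
    [DecidableEq m] [DecidableEq l] [CommSemiring α] (p : m → α) {R : Matrix (m × l) (m × l) α}
    (hR : ∀ i j a b, i ≠ j → R (i, a) (j, b) = 0) :
    Commute (diagonal p ⊗ₖ (1 : Matrix l l α)) R := by
  rw [← diagonal_one, diagonal_kronecker_diagonal]
  ext ⟨i, a⟩ ⟨j, b⟩
  rw [diagonal_mul, mul_diagonal]
  by_cases h : i = j
  · subst h
    simp [mul_comm]
  · simp [hR i j a b h]

/-- Lyapunov derivative computation of the paper's Proposition 1: along the
closed-loop error dynamics
`x̄ₑ′ = −k₁(M⊗I₂)x̄ₑ − k₂Rδ̃`, `δ̃′ = k₂Rᵀx̄ₑ`, with `P = diag(p)` positive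
definite and `R(t)` block diagonal with 2×2 blocks, the function
`V = x̄ₑᵀ(P⊗I₂)x̄ₑ + δ̃ᵀ(P⊗I₂)δ̃` satisfies `V′ = −k₁ x̄ₑᵀ(Q⊗I₂)x̄ₑ`
where `Q = PM + MᵀP`. -/
theorem stmt11 (n : ℕ) (hn : 1 ≤ n) (k₁ k₂ : ℝ) (hk₁ : 0 < k₁) (hk₂ : 0 < k₂)
    (p : Fin n → ℝ) (hp : (diagonal p).PosDef)
    (M : Matrix (Fin n) (Fin n) ℝ)
    (x δ : ℝ → Fin n × Fin 2 → ℝ)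
    (hx : Differentiable ℝ x) (hδ : Differentiable ℝ δ)
    (R : ℝ → Matrix (Fin n × Fin 2) (Fin n × Fin 2) ℝ)
    (hR : ∀ t i j a b, i ≠ j → R t (i, a) (j, b) = 0)
    (hx' : ∀ t, deriv x t
        = -(k₁ • ((M ⊗ₖ (1 : Matrix (Fin 2) (Fin 2) ℝ)) *ᵥ x t)) - k₂ • (R t *ᵥ δ t))
    (hδ' : ∀ t, deriv δ t = k₂ • ((R t)ᵀ *ᵥ x t))
    (V : ℝ → ℝ)
    (hV : ∀ t, V t
        = x t ⬝ᵥ ((diagonal p ⊗ₖ (1 : Matrix (Fin 2) (Fin 2) ℝ)) *ᵥ x t)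
          + δ t ⬝ᵥ ((diagonal p ⊗ₖ (1 : Matrix (Fin 2) (Fin 2) ℝ)) *ᵥ δ t)) :
    Differentiable ℝ V ∧
    ∀ t, deriv V t
        = -(k₁ * (x t ⬝ᵥ (((diagonal p * M + Mᵀ * diagonal p) ⊗ₖ
            (1 : Matrix (Fin 2) (Fin 2) ℝ)) *ᵥ x t))) := by
  set K := diagonal p ⊗ₖ (1 : Matrix (Fin 2) (Fin 2) ℝ) with hK
  set N := M ⊗ₖ (1 : Matrix (Fin 2) (Fin 2) ℝ) with hN
  have hKs : K.IsSymm := by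
    rw [Matrix.IsSymm, hK, ← kroneckerMap_transpose, diagonal_transpose, transpose_one]
  have hQ : (diagonal p * M + Mᵀ * diagonal p) ⊗ₖ (1 : Matrix (Fin 2) (Fin 2) ℝ)
      = K * N + Nᵀ * K := by
    rw [hK, hN, ← kroneckerMap_transpose, ← mul_kronecker_mul, ← mul_kronecker_mul, transpose_one,
      one_mul, ← add_kronecker]
  have hV' : ∀ t, HasDerivAt V
      (-(k₁ * (x t ⬝ᵥ (((diagonal p * M + Mᵀ * diagonal p) ⊗ₖ
            (1 : Matrix (Fin 2) (Fin 2) ℝ)) *ᵥ x t)))) t := by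
    intro t
    have hsum := ((hx t).hasDerivAt.dotProduct_mulVec_self hKs).add
      ((hδ t).hasDerivAt.dotProduct_mulVec_self hKs)
    rw [funext hV]
    refine hsum.congr_deriv ?_
    have hcross : δ t ⬝ᵥ (K *ᵥ ((R t)ᵀ *ᵥ x t)) = x t ⬝ᵥ (K *ᵥ (R t *ᵥ δ t)) := by
      rw [hKs.dotProduct_mulVec_comm, mulVec_transpose, ← dotProduct_mulVec, mulVec_mulVec,
        mulVec_mulVec, (commute_diagonal_kronecker_one p (hR t)).eq]
    have hsymm : x t ⬝ᵥ (Nᵀ *ᵥ (K *ᵥ x t)) = x t ⬝ᵥ (K *ᵥ (N *ᵥ x t)) := by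
      rw [hKs.dotProduct_mulVec_comm, mulVec_transpose, dotProduct_comm, ← dotProduct_mulVec,
        dotProduct_comm]
    rw [hx' t, hδ' t, hQ, add_mulVec, ← mulVec_mulVec, ← mulVec_mulVec]
    simp only [mulVec_sub, mulVec_neg, mulVec_smul, dotProduct_sub, dotProduct_neg,
      dotProduct_smul, dotProduct_add, smul_eq_mul, hcross, hsymm]
    ring
  exact ⟨fun t => (hV' t).differentiableAt, fun t => (hV' t).deriv⟩
end
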